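/- Let n ≥ 2 and N = 2^n. Let W ⊆ S ⊆ Fin N with |W| = N/4 and |S| = N/2. Define a₀ : Fin N → ℝ by a₀(i) = √(2/N) if i ∈ S and 0 otherwise, and let a_t = T_W^t a₀ where T_W is the modified GSA iteration for marked set W. Then the full amplitude vector is periodic with period 6: a_{t+6} = a_t for all t ≥ 0. In particular, iterating the modified GSA never increases the marked-state probability above its value along this six-step cycle. -/

import Mathlib

/-- Modified GSA iteration: with `D = (2/N) * (∑_{j ∉ W} a j - ∑_{i ∈ W} a i)`,
the new amplitude is `D + a i` for marked states `i ∈ W` and `D - a j` otherwise. -/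
noncomputable def gsaStep (N : ℕ) (W : Finset (Fin N)) (a : Fin N → ℝ) : Fin N → ℝ :=
  fun i =>
    (2 / (N : ℝ)) * ((∑ j ∈ Wᶜ, a j) - ∑ j ∈ W, a j) + (if i ∈ W then a i else - a i)

/-- The common shift `D` added to every amplitude by one iteration. -/
noncomputable def gsaShift (N : ℕ) (W : Finset (Fin N)) (a : Fin N → ℝ) : ℝ :=
  (2 / (N : ℝ)) * ((∑ j ∈ Wᶜ, a j) - ∑ j ∈ W, a j)

theorem gsaStep_apply_mem {N : ℕ} {W : Finset (Fin N)} (a : Fin N → ℝ) {i : Fin N}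
    (hi : i ∈ W) : gsaStep N W a i = gsaShift N W a + a i := by
  simp [gsaStep, gsaShift, hi]

theorem gsaStep_apply_notMem {N : ℕ} {W : Finset (Fin N)} (a : Fin N → ℝ) {i : Fin N}
    (hi : i ∉ W) : gsaStep N W a i = gsaShift N W a - a i := by
  simp [gsaStep, gsaShift, hi, sub_eq_add_neg]

theorem sum_gsaStep {N : ℕ} (W : Finset (Fin N)) (a : Fin N → ℝ) :
    ∑ i ∈ W, gsaStep N W a i = W.card * gsaShift N W a + ∑ i ∈ W, a i := by
  rw [Finset.sum_congr rfl fun i hi => gsaStep_apply_mem a hi, Finset.sum_add_distrib]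
  simp

theorem sum_compl_gsaStep {N : ℕ} (W : Finset (Fin N)) (a : Fin N → ℝ) :
    ∑ i ∈ Wᶜ, gsaStep N W a i = (N - W.card) * gsaShift N W a - ∑ i ∈ Wᶜ, a i := by
  have hcard : ((Wᶜ.card : ℕ) : ℝ) = N - W.card := by
    rw [Finset.card_compl, Fintype.card_fin, Nat.cast_sub (by simpa using W.card_le_univ)]
  rw [Finset.sum_congr rfl fun i hi => gsaStep_apply_notMem a (Finset.mem_compl.mp hi),
    Finset.sum_sub_distrib, Finset.sum_const, nsmul_eq_mul, hcard]

/-- When a quarter of the states are marked, each shift is the difference of the previous two. -/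
theorem gsaShift_gsaStep_gsaStep {N : ℕ} (hN : 0 < N) {W : Finset (Fin N)}
    (hW : 4 * W.card = N) (a : Fin N → ℝ) :
    gsaShift N W (gsaStep N W (gsaStep N W a)) =
      gsaShift N W (gsaStep N W a) - gsaShift N W a := by
  have hN' : (N : ℝ) ≠ 0 := by positivity
  have hW' : (W.card : ℝ) = N / 4 := by
    rw [eq_div_iff (by norm_num), mul_comm]
    exact_mod_cast hW
  simp only [gsaShift, sum_gsaStep, sum_compl_gsaStep, hW']
  field_simp
  ring

/-- When a quarter of the states are marked, the modified GSA iteration has period six on every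
amplitude vector. -/
theorem gsaStep_iterate_six {N : ℕ} (hN : 0 < N) {W : Finset (Fin N)}
    (hW : 4 * W.card = N) (a : Fin N → ℝ) : (gsaStep N W)^[6] a = a := by
  have h := gsaShift_gsaStep_gsaStep hN hW
  funext i
  by_cases hi : i ∈ W
  · simp only [Function.iterate_succ, Function.iterate_zero, Function.comp_apply, id_eq,
      gsaStep_apply_mem _ hi, h]
    ring
  · simp only [Function.iterate_succ, Function.iterate_zero, Function.comp_apply, id_eq,
      gsaStep_apply_notMem _ hi, h]
    ring

/-- With `|W| = N/4` marked states inside a support `S` of size `N/2` on which the initial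
amplitudes are all `√(2/N)`, the full amplitude vector of the modified GSA is periodic with
period 6: `a_{t+6} = a_t` for all `t ≥ 0`. -/
theorem modifiedGSA_periodic_six
    (n : ℕ) (hn : 2 ≤ n) (N : ℕ) (hN : N = 2 ^ n)
    (W S : Finset (Fin N)) (hWS : W ⊆ S)
    (hW : W.card = N / 4) (hS : S.card = N / 2)
    (a₀ : Fin N → ℝ)
    (ha₀ : ∀ i, a₀ i = if i ∈ S then Real.sqrt (2 / (N : ℝ)) else 0) :
    ∀ t : ℕ, (gsaStep N W)^[t + 6] a₀ = (gsaStep N W)^[t] a₀ := by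
  have hdvd : 4 ∣ N := by
    rw [hN]
    exact pow_dvd_pow 2 hn
  have hpos : 0 < N := by
    rw [hN]
    positivity
  have hcard : 4 * W.card = N := by rw [hW, Nat.mul_div_cancel' hdvd]
  intro t
  rw [Function.iterate_add_apply, gsaStep_iterate_six hpos hcard]
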